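/- arXiv:2104.09593 — 3 statements merged into one kernel-verified Lean document; each statement's English description precedes it below -/
import Mathlib

section
/- Let L>0 and let ξ:(0,L)→ℝ be three times differentiable with ξ(x)>0 and ξ'(x)>0 for all x∈(0,L). Let k:(0,∞)→ℝ be twice differentiable and satisfy the modified Bessel equation of order 1/3, i.e. z²k''(z)+z k'(z)−(z²+1/9)k(z)=0 for all z>0. Then the function ψ(x)=√(ξ(x)/ξ'(x))·k(ξ(x)) is twice differentiable on (0,L) and satisfies ψ''(x)=((ξ'(x))²−T(x))ψ(x) for all x∈(0,L), where T(x)=(1/4)[(5/9)(ξ'(x)/ξ(x))²+2ξ'''(x)/ξ'(x)−3(ξ''(x)/ξ'(x))²]. -/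
open Set

/-- The derivative of `√(f / g)` in logarithmic form. -/
theorem HasDerivAt.sqrt_div_of_pos {f g : ℝ → ℝ} {f' g' x : ℝ}
    (hf : HasDerivAt f f' x) (hg : HasDerivAt g g' x) (hfx : 0 < f x) (hgx : 0 < g x) :
    HasDerivAt (fun t => Real.sqrt (f t / g t))
      (Real.sqrt (f x / g x) * ((1 / 2) * (f' / f x - g' / g x))) x := by
  have hpos : 0 < f x / g x := div_pos hfx hgx
  refine ((hf.fun_div hg hgx.ne').sqrt hpos.ne').congr_deriv ?_
  have hs : Real.sqrt (f x / g x) ≠ 0 := (Real.sqrt_pos.2 hpos).ne'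
  rw [div_eq_iff (mul_ne_zero two_ne_zero hs)]
  have hsq : Real.sqrt (f x / g x) * Real.sqrt (f x / g x) = f x / g x :=
    Real.mul_self_sqrt hpos.le
  calc (f' * g x - f x * g') / g x ^ 2
      = (f x / g x) * (f' / f x - g' / g x) := by field_simp
    _ = (Real.sqrt (f x / g x) * Real.sqrt (f x / g x)) * (f' / f x - g' / g x) := by rw [hsq]
    _ = _ := by ring

/-- Liouville-transformation identity (Lemma A.1, exponential case):
if `k` solves the modified Bessel equation of order `1/3` on `(0,∞)` and `ξ` is positive
and increasing on `(0,L)`, then `ψ = √(ξ/ξ') · k∘ξ` satisfies `ψ'' = ((ξ')² - T) ψ`. -/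
theorem stmt0 (L : ℝ) (hL : 0 < L)
    (ξ ξ' ξ'' ξ''' : ℝ → ℝ)
    (hξ : ∀ x ∈ Ioo (0:ℝ) L, HasDerivAt ξ (ξ' x) x)
    (hξ' : ∀ x ∈ Ioo (0:ℝ) L, HasDerivAt ξ' (ξ'' x) x)
    (hξ'' : ∀ x ∈ Ioo (0:ℝ) L, HasDerivAt ξ'' (ξ''' x) x)
    (hξpos : ∀ x ∈ Ioo (0:ℝ) L, 0 < ξ x)
    (hξ'pos : ∀ x ∈ Ioo (0:ℝ) L, 0 < ξ' x)
    (k k' k'' : ℝ → ℝ)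
    (hk : ∀ z : ℝ, 0 < z → HasDerivAt k (k' z) z)
    (hk' : ∀ z : ℝ, 0 < z → HasDerivAt k' (k'' z) z)
    (hbessel : ∀ z : ℝ, 0 < z → z ^ 2 * k'' z + z * k' z - (z ^ 2 + 1 / 9) * k z = 0) :
    ∃ ψ' : ℝ → ℝ, ∀ x ∈ Ioo (0:ℝ) L,
      HasDerivAt (fun t => Real.sqrt (ξ t / ξ' t) * k (ξ t)) (ψ' x) x ∧
      HasDerivAt ψ'
        (((ξ' x) ^ 2 -
            (1 / 4) * ((5 / 9) * (ξ' x / ξ x) ^ 2 + 2 * ξ''' x / ξ' x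
              - 3 * (ξ'' x / ξ' x) ^ 2)) *
          (Real.sqrt (ξ x / ξ' x) * k (ξ x))) x := by
  refine ⟨fun t => Real.sqrt (ξ t / ξ' t) *
    ((1 / 2) * (ξ' t / ξ t - ξ'' t / ξ' t) * k (ξ t) + ξ' t * k' (ξ t)), fun x hx => ?_⟩
  have h0 := hξpos x hx
  have h1 := hξ'pos x hx
  have hs := (hξ x hx).sqrt_div_of_pos (hξ' x hx) h0 h1
  have hkξ : HasDerivAt (fun t => k (ξ t)) (k' (ξ x) * ξ' x) x :=
    (hk _ h0).comp x (hξ x hx)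
  have hk'ξ : HasDerivAt (fun t => k' (ξ t)) (k'' (ξ x) * ξ' x) x :=
    (hk' _ h0).comp x (hξ x hx)
  refine ⟨(hs.fun_mul hkξ).congr_deriv (by ring), ?_⟩
  have hr := (((hξ' x hx).fun_div (hξ x hx) h0.ne').fun_sub
    ((hξ'' x hx).fun_div (hξ' x hx) h1.ne')).const_mul (1 / 2 : ℝ)
  refine (hs.fun_mul ((hr.fun_mul hkξ).fun_add ((hξ' x hx).fun_mul hk'ξ))).congr_deriv ?_
  have hk''x : k'' (ξ x) = ((ξ x ^ 2 + 1 / 9) * k (ξ x) - ξ x * k' (ξ x)) / ξ x ^ 2 := by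
    rw [eq_div_iff (pow_ne_zero 2 h0.ne')]
    linarith [hbessel _ h0]
  rw [hk''x]
  generalize Real.sqrt (ξ x / ξ' x) = s
  field_simp
  ring
end

section
/- Let 0<δ<L, λ₀>0, and c,C>0. Let μ:[0,L]×(λ₀,∞)→ℝ be such that for each λ the map x↦μ(x,λ) is twice continuously differentiable, and assume for all (x,λ)∈[0,L]×(λ₀,∞): (i) μ(x,λ)≤−cλ; (ii) |μ(x,λ)|≤C(1+λ); (iii) |∂ₓμ(x,λ)|≤C; (iv) |∂ₓ²μ(x,λ)|≤C. Define ξ(x,λ)=∫₀ˣ√(−μ(t,λ))dt and T(x;λ)=(1/4)[−(5/9)·μ(x,λ)/ξ(x,λ)² + ∂ₓ²μ(x,λ)/μ(x,λ) − (5/4)·(∂ₓμ(x,λ))²/μ(x,λ)²]. Then T is bounded on [δ,L]×(λ₀,∞), i.e. there exists T₀>0 with |T(x;λ)|≤T₀ for all x∈[δ,L] and λ>λ₀. -/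
open Set

theorem sq_mul_le_sq_integral_sqrt {f : ℝ → ℝ} {δ x k : ℝ} (hδ : 0 ≤ δ) (hδx : δ ≤ x)
    (hk : 0 ≤ k) (hf : ContinuousOn f (Icc 0 x)) (hkf : ∀ t ∈ Icc 0 x, k ≤ f t) :
    δ ^ 2 * k ≤ (∫ t in (0:ℝ)..x, Real.sqrt (f t)) ^ 2 := by
  have hx : 0 ≤ x := hδ.trans hδx
  have hint : x * Real.sqrt k ≤ ∫ t in (0:ℝ)..x, Real.sqrt (f t) := by
    calc x * Real.sqrt k = ∫ _ in (0:ℝ)..x, Real.sqrt k := by simp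
      _ ≤ _ := by
        refine intervalIntegral.integral_mono_on hx intervalIntegrable_const
          (hf.sqrt.intervalIntegrable_of_Icc hx) fun t ht => ?_
        exact Real.sqrt_le_sqrt (hkf t ht)
  calc δ ^ 2 * k = (δ * Real.sqrt k) ^ 2 := by rw [mul_pow, Real.sq_sqrt hk]
    _ ≤ (x * Real.sqrt k) ^ 2 := by gcongr
    _ ≤ _ := by gcongr

/-- Second Proposition of Section 3: if `μ(x,λ) ≤ -cλ`, `|μ| ≤ C(1+λ)` and the first two
`x`-derivatives of `μ` are bounded by `C`, then the correction function
`T(x;λ) = (1/4)[-(5/9) μ/ξ² + μ''/μ - (5/4) μ'²/μ²]`, with `ξ(x,λ) = ∫₀ˣ √(-μ(t,λ)) dt`,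
is bounded on `[δ,L] × (λ₀,∞)`. -/
theorem stmt6 (L δ lam0 c C : ℝ) (hδ : 0 < δ) (hδL : δ < L) (hlam0 : 0 < lam0)
    (hc : 0 < c) (hC : 0 < C)
    (μ μ' μ'' : ℝ → ℝ → ℝ)
    (hdiff : ∀ lam : ℝ, lam0 < lam → ∀ x ∈ Icc (0:ℝ) L,
      HasDerivAt (fun t => μ t lam) (μ' x lam) x)
    (hdiff2 : ∀ lam : ℝ, lam0 < lam → ∀ x ∈ Icc (0:ℝ) L,
      HasDerivAt (fun t => μ' t lam) (μ'' x lam) x)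
    (hcont : ∀ lam : ℝ, lam0 < lam → ContinuousOn (fun x => μ'' x lam) (Icc 0 L))
    (h1 : ∀ lam : ℝ, lam0 < lam → ∀ x ∈ Icc (0:ℝ) L, μ x lam ≤ -c * lam)
    (h2 : ∀ lam : ℝ, lam0 < lam → ∀ x ∈ Icc (0:ℝ) L, |μ x lam| ≤ C * (1 + lam))
    (h3 : ∀ lam : ℝ, lam0 < lam → ∀ x ∈ Icc (0:ℝ) L, |μ' x lam| ≤ C)
    (h4 : ∀ lam : ℝ, lam0 < lam → ∀ x ∈ Icc (0:ℝ) L, |μ'' x lam| ≤ C) :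
    ∃ T0 : ℝ, 0 < T0 ∧ ∀ x ∈ Icc δ L, ∀ lam : ℝ, lam0 < lam →
      |(1/4) * (-(5/9) * μ x lam / (∫ t in (0:ℝ)..x, Real.sqrt (-μ t lam)) ^ 2
          + μ'' x lam / μ x lam
          - (5/4) * (μ' x lam) ^ 2 / (μ x lam) ^ 2)| ≤ T0 := by
  have hA : 0 < C * (1 / lam0 + 1) / (δ ^ 2 * c) := by positivity
  have hB : 0 < C / (c * lam0) := by positivity
  refine ⟨C * (1 / lam0 + 1) / (δ ^ 2 * c) + C / (c * lam0) + (C / (c * lam0)) ^ 2,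
    by positivity, ?_⟩
  intro x hx lam hlam
  have hlampos : 0 < lam := hlam0.trans hlam
  have hx0 : 0 ≤ x := hδ.le.trans hx.1
  have hxL : x ∈ Icc (0:ℝ) L := ⟨hx0, hx.2⟩
  have hξ : δ ^ 2 * c * lam ≤ (∫ t in (0:ℝ)..x, Real.sqrt (-μ t lam)) ^ 2 := by
    rw [mul_assoc]
    refine sq_mul_le_sq_integral_sqrt (k := c * lam) hδ.le hx.1 (by positivity) ?_ ?_
    · intro t ht
      exact (hdiff lam hlam t ⟨ht.1, ht.2.trans hx.2⟩).continuousAt.continuousWithinAt.neg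
    · intro t ht
      linarith [h1 lam hlam t ⟨ht.1, ht.2.trans hx.2⟩]
  have hμ : c * lam0 ≤ |μ x lam| := by
    have hmul : c * lam0 ≤ c * lam := by gcongr
    linarith [h1 lam hlam x hxL, neg_le_abs (μ x lam)]
  have hfst : |μ x lam / (∫ t in (0:ℝ)..x, Real.sqrt (-μ t lam)) ^ 2|
      ≤ C * (1 / lam0 + 1) / (δ ^ 2 * c) := by
    rw [abs_div, abs_of_nonneg (sq_nonneg (∫ t in (0:ℝ)..x, Real.sqrt (-μ t lam)))]
    calc _ ≤ C * (1 + lam) / (δ ^ 2 * c * lam) := by gcongr; exact h2 lam hlam x hxL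
      _ = C * (1 / lam + 1) / (δ ^ 2 * c) := by field_simp
      _ ≤ _ := by gcongr
  have hsnd : |μ'' x lam / μ x lam| ≤ C / (c * lam0) := by
    rw [abs_div]
    gcongr
    exact h4 lam hlam x hxL
  have hthd : |(μ' x lam / μ x lam) ^ 2| ≤ (C / (c * lam0)) ^ 2 := by
    rw [abs_pow, abs_div]
    gcongr
    exact h3 lam hlam x hxL
  rw [mul_div_assoc, mul_div_assoc, ← div_pow]
  rw [abs_le] at hfst hsnd hthd ⊢
  have hB2 : 0 < (C / (c * lam0)) ^ 2 := by positivity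
  constructor <;> linarith [hfst.1, hfst.2, hsnd.1, hsnd.2, hthd.1, hthd.2]
end

section
/- Let L>0, 0<ρ<L, M>0, T₀>0, and let μ:[0,L]→ℝ be continuous with μ(x)≤μ*<0 for all x∈[0,L]. Define w₁(x)=(−μ(x))^{1/4} and w₂(x)=exp(∫₀ˣ√(−μ(t))dt), and set W=sup_{0≤x≤s≤L} w₁(s)/w₁(x) (finite by continuity and negativity of μ). Let u,v:[0,L]→ℝ satisfy |u(x)|≤M/(w₁(x)w₂(x)) and |v(x)|≤M·w₂(x)/w₁(x), write u₁₂=w₁w₂u, v₁₂=w₁w₂v, and let T:[0,L]→ℝ be measurable with |T(s)|≤T₀ for s∈[ρ,L]. Then for every x∈[0,L]: ∫_{max(x,ρ)}^{L} |T(s)|·|u₁₂(x)v₁₂(s)−v₁₂(x)u₁₂(s)|/(w₂(s)²·w₁(s)²) ds ≤ (1/√(−μ*))·T₀·M²·(1+W)·L. -/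
open Set

/-- The square of a fourth root is the square root. -/
theorem quarter_rpow_sq {a : ℝ} (ha : 0 ≤ a) : (a ^ (1 / 4 : ℝ)) ^ 2 = √a := by
  rw [← Real.rpow_natCast, ← Real.rpow_mul ha, Real.sqrt_eq_rpow]
  norm_num

/-- Operator-norm estimate for the weighted integral operator `A₁₂` (Section 2.1):
away from the origin the integrand is bounded by `T₀ M² (1+W)/√(-μ*)`, whence the
integral over `[max(x,ρ), L]` is at most `(1/√(-μ*)) T₀ M² (1+W) L`. -/
theorem stmt8 (L ρ M T0 μstar W : ℝ) (hL : 0 < L) (hρ : 0 < ρ) (hρL : ρ < L)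
    (hM : 0 < M) (hT0 : 0 < T0) (hμstar : μstar < 0)
    (μ : ℝ → ℝ) (hμc : ContinuousOn μ (Icc 0 L))
    (hμ : ∀ x ∈ Icc (0:ℝ) L, μ x ≤ μstar)
    (w1 w2 : ℝ → ℝ)
    (hw1 : ∀ x, w1 x = (-μ x) ^ (1/4 : ℝ))
    (hw2 : ∀ x, w2 x = Real.exp (∫ t in (0:ℝ)..x, Real.sqrt (-μ t)))
    (hW : ∀ x ∈ Icc (0:ℝ) L, ∀ s ∈ Icc x L, w1 s / w1 x ≤ W)
    (u v : ℝ → ℝ)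
    (hu : ∀ x ∈ Icc (0:ℝ) L, |u x| ≤ M / (w1 x * w2 x))
    (hv : ∀ x ∈ Icc (0:ℝ) L, |v x| ≤ M * w2 x / w1 x)
    (T : ℝ → ℝ) (hTmeas : Measurable T)
    (hT : ∀ s ∈ Icc ρ L, |T s| ≤ T0) :
    ∀ x ∈ Icc (0:ℝ) L,
      (∫ s in (max x ρ)..L,
          |T s| * |(w1 x * w2 x * u x) * (w1 s * w2 s * v s)
              - (w1 x * w2 x * v x) * (w1 s * w2 s * u s)|
            / ((w2 s) ^ 2 * (w1 s) ^ 2))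
        ≤ (1 / Real.sqrt (-μstar)) * T0 * M ^ 2 * (1 + W) * L := by
  intro x hx
  have hpos1 : ∀ y ∈ Icc (0 : ℝ) L, 0 < w1 y := fun y hy => by
    rw [hw1]
    exact Real.rpow_pos_of_pos (by linarith [hμ y hy]) _
  have hW1 : 1 ≤ W := by
    have h := hW x hx x ⟨le_rfl, hx.2⟩
    rwa [div_self (hpos1 x hx).ne'] at h
  have hxL : max x ρ ≤ L := max_le hx.2 hρL.le
  have hx0 : 0 ≤ max x ρ := hx.1.trans (le_max_left _ _)
  have hsqrt : 0 < √(-μstar) := Real.sqrt_pos.2 (by linarith)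
  have hbound : ∀ s ∈ uIoc (max x ρ) L,
      ‖|T s| * |(w1 x * w2 x * u x) * (w1 s * w2 s * v s)
          - (w1 x * w2 x * v x) * (w1 s * w2 s * u s)| / ((w2 s) ^ 2 * (w1 s) ^ 2)‖
        ≤ (1 / √(-μstar)) * T0 * M ^ 2 * (1 + W) := by
    intro s hs
    rw [uIoc_of_le hxL] at hs
    have hxs : x ≤ s := (le_max_left x ρ).trans hs.1.le
    have hs' : s ∈ Icc (0 : ℝ) L := ⟨hx.1.trans hxs, hs.2⟩
    have hTs : |T s| ≤ T0 := hT s ⟨(le_max_right x ρ).trans hs.1.le, hs.2⟩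
    have hw1sq : √(-μstar) ≤ w1 s ^ 2 := by
      rw [hw1, quarter_rpow_sq (by linarith [hμ s hs'])]
      exact Real.sqrt_le_sqrt (by linarith [hμ s hs'])
    have hpos2 : ∀ y, 0 < w2 y := fun y => by rw [hw2]; exact Real.exp_pos _
    have hmono : w2 x ≤ w2 s := by
      rw [hw2, hw2]
      refine Real.exp_le_exp.2 (intervalIntegral.integral_mono_interval le_rfl hx.1 hxs
        (Filter.Eventually.of_forall fun t => Real.sqrt_nonneg _) ?_)
      refine (ContinuousOn.sqrt (hμc.mono ?_).neg).intervalIntegrable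
      rw [uIcc_of_le hs'.1]
      exact Icc_subset_Icc_right hs'.2
    have hU : ∀ y ∈ Icc (0 : ℝ) L, |w1 y * w2 y * u y| ≤ M := fun y hy => by
      have h := mul_pos (hpos1 y hy) (hpos2 y)
      rw [abs_mul, abs_of_pos h, mul_comm]
      exact (le_div_iff₀ h).1 (hu y hy)
    have hV : ∀ y ∈ Icc (0 : ℝ) L, |w1 y * w2 y * v y| ≤ M * w2 y ^ 2 := fun y hy => by
      have h := (le_div_iff₀ (hpos1 y hy)).1 (hv y hy)
      rw [abs_mul, abs_of_pos (mul_pos (hpos1 y hy) (hpos2 y))]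
      nlinarith [mul_le_mul_of_nonneg_right h (hpos2 y).le]
    have hsq : w2 x ^ 2 ≤ w2 s ^ 2 := pow_le_pow_left₀ (hpos2 x).le hmono 2
    have hnum : |(w1 x * w2 x * u x) * (w1 s * w2 s * v s)
        - (w1 x * w2 x * v x) * (w1 s * w2 s * u s)| ≤ M ^ 2 * (1 + W) * w2 s ^ 2 := by
      calc _ ≤ |w1 x * w2 x * u x| * |w1 s * w2 s * v s|
              + |w1 x * w2 x * v x| * |w1 s * w2 s * u s| := by
            rw [← abs_mul, ← abs_mul]
            exact abs_sub _ _
        _ ≤ M * (M * w2 s ^ 2) + (M * w2 s ^ 2) * M := by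
            gcongr
            · exact hU x hx
            · exact hV s hs'
            · exact (hV x hx).trans (by gcongr)
            · exact hU s hs'
        _ = M ^ 2 * (1 + 1) * w2 s ^ 2 := by ring
        _ ≤ _ := by gcongr
    have hw2s := hpos2 s
    rw [Real.norm_of_nonneg (by positivity)]
    calc _ ≤ T0 * (M ^ 2 * (1 + W) * w2 s ^ 2) / (w2 s ^ 2 * √(-μstar)) := by gcongr
      _ = _ := by field_simp
  calc _ ≤ _ := Real.le_norm_self _
    _ ≤ _ := intervalIntegral.norm_integral_le_of_norm_le_const hbound
    _ ≤ _ := by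
      gcongr
      rw [abs_of_nonneg (by linarith)]
      linarith
end
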